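/- The 3x+1 conjecture holds if and only if for every positive integer n, the Turing machine M5 halts when started from the initial configuration ωb (A 1) 1^{n−1} bω (the number n written in unary). -/

import Mathlib

namespace Collatz

/-- The 3x+1 function. -/
def T (x : ℕ) : ℕ := if x % 2 = 0 then x / 2 else (3 * x + 1) / 2

/-- The 3x+1 conjecture: iterating `T` from any positive integer
eventually reaches the loop `2 ↦ 1 ↦ 2`. -/
def CollatzConjecture : Prop :=
  ∀ x : ℕ, 0 < x → ∃ k : ℕ, T^[k] x = 2 ∧ T^[k + 1] x = 1

inductive St | A | B | C | D | H
  deriving DecidableEq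

inductive Sym | sb | s1 | sx | sa | sz | sr
  deriving DecidableEq

open St Sym

/-- Transition table of the Turing machine `M5`
(`true` = move right, `false` = move left); `H` is the halting state. -/
def delta : St → Sym → Option (Sym × Bool × St)
  | A, sb => some (sb, true, A)
  | A, s1 => some (sx, true, D)
  | A, sx => some (s1, false, A)
  | A, sa => some (s1, false, A)
  | A, sz => some (sr, true, B)
  | A, sr => none
  | B, sb => some (s1, false, B)
  | B, s1 => some (sa, true, C)
  | B, sx => some (s1, false, B)
  | B, sa => some (s1, false, A)
  | B, sz => some (sx, true, B)
  | B, sr => some (sb, true, A)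
  | C, sb => some (sz, false, C)
  | C, s1 => some (sx, true, C)
  | C, sx => some (s1, false, C)
  | C, sa => some (sa, true, A)
  | C, sz => some (sr, true, C)
  | C, sr => some (sz, false, C)
  | D, sb => some (sb, false, H)
  | D, s1 => some (sa, true, C)
  | D, sz => some (sx, true, B)
  | D, _  => none
  | H, _  => none

structure Cfg where
  state : St
  head : ℤ
  tape : ℤ → Sym

/-- One step of the machine; `none` when the transition is undefined
(in particular in the halting state, which has no transitions).
In `delta`, the `Bool` component is the direction: `true` = right, `false` = left. -/
def step (c : Cfg) : Option Cfg :=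
  (delta c.state (c.tape c.head)).map fun t =>
    ⟨t.2.2, c.head + (if t.2.1 then 1 else -1), Function.update c.tape c.head t.1⟩

/-- `steps n c` is the configuration after `n` steps from `c`
(`none` if the machine has halted meanwhile). -/
def steps : ℕ → Cfg → Option Cfg
  | 0, c => some c
  | n + 1, c => (step c).bind (steps n)

/-- The tape holding the word `w` at positions `0, …, w.length - 1`,
and the blank symbol everywhere else. -/
def tapeOf (w : List Sym) : ℤ → Sym :=
  fun i => if 0 ≤ i then w.getD i.toNat sb else sb

/-- `c` is the configuration `ωb u (q s) v bω`, where `w = u ++ s :: v` and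
`pos = u.length` (i.e. the tape holds exactly the word `w` surrounded by blanks,
the machine is in state `q`, and the head scans the symbol of `w` at index `pos`). -/
def IsConfig (c : Cfg) (q : St) (w : List Sym) (pos : ℕ) : Prop :=
  c.state = q ∧ ∃ d : ℤ, c.head = d + pos ∧ c.tape = fun i => tapeOf w (i - d)

/-- The machine eventually reaches the configuration `ωb u (q s) v bω`. -/
def Reaches (c : Cfg) (q : St) (w : List Sym) (pos : ℕ) : Prop :=
  ∃ t : ℕ, ∃ c' : Cfg, steps t c = some c' ∧ IsConfig c' q w pos

/-- The machine halts when started from configuration `c`. -/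
def Halts (c : Cfg) : Prop := ∃ n : ℕ, steps n c = none

/-- Initial configuration: word `w` on the tape, head on its leftmost symbol, state `A`. -/
def initCfg (w : List Sym) : Cfg := ⟨St.A, 0, tapeOf w⟩

/-- Zipper configurations: state, left part (reversed), right part (head on its first symbol). -/
abbrev Z := St × List Sym × List Sym

/-- Move the head one cell to the left of the right part `R`. -/
def ml (q : St) (L R : List Sym) : Z := (q, L.tail, L.headD sb :: R)

def zstep (z : Z) : Option Z :=
  (delta z.1 (z.2.2.headD sb)).map fun t =>
    if t.2.1 then (t.2.2, t.1 :: z.2.1, z.2.2.tail) else ml t.2.2 z.2.1 (t.1 :: z.2.2.tail)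

def zsteps : ℕ → Z → Option Z
  | 0, z => some z
  | n + 1, z => (zstep z).bind (zsteps n)

def Rep (c : Cfg) (z : Z) : Prop :=
  c.state = z.1 ∧ (∀ i : ℕ, c.tape (c.head - 1 - i) = z.2.1.getD i sb) ∧
    (∀ i : ℕ, c.tape (c.head + i) = z.2.2.getD i sb)

theorem headD_eq (L : List Sym) : L.headD sb = L.getD 0 sb := by cases L <;> simp

theorem getD_tail (L : List Sym) (i : ℕ) : L.tail.getD i sb = L.getD (i + 1) sb := by
  cases L <;> simp

theorem Rep.step_none {c : Cfg} {z : Z} (h : Rep c z) (hz : zstep z = none) : step c = none := by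
  obtain ⟨h1, h2, h3⟩ := h
  have h0 := h3 0
  simp only [Nat.cast_zero, add_zero] at h0
  simp only [zstep, step, h1, h0, headD_eq, Option.map_eq_none_iff] at *
  exact hz

theorem Rep.step_some {c : Cfg} {z z' : Z} (h : Rep c z) (hz : zstep z = some z') :
    ∃ c', step c = some c' ∧ Rep c' z' := by
  obtain ⟨h1, h2, h3⟩ := h
  have h0 := h3 0
  simp only [Nat.cast_zero, add_zero] at h0
  simp only [zstep, headD_eq, Option.map_eq_some_iff] at hz
  obtain ⟨⟨w, d, q⟩, hd, hz⟩ := hz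
  refine ⟨⟨q, c.head + (if d then 1 else -1), Function.update c.tape c.head w⟩,
    by simp only [step, h1, h0, hd, Option.map_some], ?_⟩
  cases d with
  | true =>
    simp only [if_true] at hz
    subst hz
    refine ⟨rfl, ?_, ?_⟩
    · intro i
      cases i with
      | zero => simp
      | succ i =>
        simp only [if_true, List.getD_cons_succ]
        rw [Function.update_of_ne (by push_cast; omega), ← h2 i]
        congr 1; push_cast; ring
    · intro i
      simp only [if_true]
      rw [Function.update_of_ne (by omega), getD_tail, ← h3]
      congr 1; push_cast; ring
  | false =>
    simp only [Bool.false_eq_true, if_false] at hz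
    subst hz
    refine ⟨rfl, ?_, ?_⟩
    · intro i
      simp only [ml, Bool.false_eq_true, if_false]
      rw [Function.update_of_ne (by omega), getD_tail, ← h2]
      congr 1; push_cast; ring
    · intro i
      simp only [ml, Bool.false_eq_true, if_false]
      match i with
      | 0 =>
        rw [Function.update_of_ne (by push_cast; omega), List.getD_cons_zero, headD_eq, ← h2]
        congr 1
      | 1 => simp
      | i + 2 =>
        rw [Function.update_of_ne (by push_cast; omega), List.getD_cons_succ,
          List.getD_cons_succ, getD_tail, ← h3]
        congr 1; push_cast; ring

theorem Rep.steps_none {n : ℕ} : ∀ {c : Cfg} {z : Z}, Rep c z →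
    (steps n c = none ↔ zsteps n z = none) := by
  induction n with
  | zero => intro c z _; simp [Collatz.steps, zsteps]
  | succ n ih =>
    intro c z h
    rcases hz : zstep z with _ | z'
    · simp [Collatz.steps, zsteps, hz, h.step_none hz]
    · obtain ⟨c', hc, h'⟩ := h.step_some hz
      simpa [Collatz.steps, zsteps, hz, hc] using ih h'

def R1 (z z' : Z) : Prop := zstep z = some z'

open Relation

theorem R1.halts {z z' : Z} (h : R1 z z') {n : ℕ} (hn : zsteps n z = none) :
    ∃ m < n, zsteps m z' = none := by
  cases n with
  | zero => simp [zsteps] at hn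
  | succ n => exact ⟨n, by omega, by simpa [zsteps, show zstep z = _ from h] using hn⟩

theorem trans_halts {z z' : Z} (h : TransGen R1 z z') : ∀ {n : ℕ}, zsteps n z = none →
    ∃ m < n, zsteps m z' = none := by
  induction h with
  | single h => exact fun hn => h.halts hn
  | tail _ h ih =>
    intro n hn
    obtain ⟨m, hm, h1⟩ := ih hn
    obtain ⟨k, hk, h2⟩ := h.halts h1
    exact ⟨k, by omega, h2⟩

theorem trans_halts_back {z z' : Z} (h : TransGen R1 z z') {m : ℕ} (hm : zsteps m z' = none) :
    ∃ n, zsteps n z = none := by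
  induction h using TransGen.head_induction_on with
  | single h => exact ⟨m + 1, by simpa [zsteps, show zstep _ = _ from h] using hm⟩
  | head h _ ih =>
    obtain ⟨n, hn⟩ := ih
    exact ⟨n + 1, by simpa [zsteps, show zstep _ = _ from h] using hn⟩

abbrev RR := ReflTransGen R1

theorem rep_shift (s : Sym) (k : ℕ) (L : List Sym) :
    List.replicate k s ++ s :: L = s :: (List.replicate k s ++ L) := by
  induction k with
  | zero => rfl
  | succ k ih => simp [List.replicate_succ, ih]

theorem sweepR {q : St} {s w : Sym} (h : delta q s = some (w, true, q)) (k : ℕ) :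
    ∀ L R : List Sym, RR (q, L, List.replicate k s ++ R) (q, List.replicate k w ++ L, R) := by
  induction k with
  | zero => intro L R; exact .refl
  | succ k ih =>
    intro L R
    refine ReflTransGen.head (b := (q, w :: L, List.replicate k s ++ R)) ?_ ?_
    · simp [R1, zstep, List.replicate_succ, h]
    · have := ih (w :: L) R
      rwa [rep_shift, ← List.cons_append, ← List.replicate_succ] at this

theorem sweepL {q : St} {s w : Sym} (h : delta q s = some (w, false, q)) (k : ℕ) :
    ∀ L R : List Sym, RR (ml q (List.replicate k s ++ L) R) (ml q L (List.replicate k w ++ R)) := by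
  induction k with
  | zero => intro L R; exact .refl
  | succ k ih =>
    intro L R
    refine ReflTransGen.head (b := ml q (List.replicate k s ++ L) (w :: R)) ?_ ?_
    · simp [R1, zstep, List.replicate_succ, h, ml]
    · have := ih L (w :: R)
      rwa [rep_shift, ← List.cons_append, ← List.replicate_succ] at this

/-- The reversed word `(xa)^k` on top of `L`. -/
def ax : ℕ → List Sym → List Sym
  | 0, L => L
  | k + 1, L => ax k (sa :: sx :: L)

theorem ax_succ (k : ℕ) : ∀ L, ax (k + 1) L = sa :: sx :: ax k L := by
  induction k with
  | zero => intro L; rfl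
  | succ k ih => intro L; rw [ax, ih]; rfl

theorem round (L : List Sym) (m j : ℕ) :
    TransGen R1 (A, L, List.replicate (m + 2) s1 ++ List.replicate j sz)
      (A, sa :: sx :: L, List.replicate m s1 ++ List.replicate (j + 1) sz) := by
  refine TransGen.head' (b := (D, sx :: L, List.replicate (m + 1) s1 ++ List.replicate j sz)) rfl ?_
  refine ReflTransGen.head
    (b := (C, sa :: sx :: L, List.replicate m s1 ++ List.replicate j sz)) rfl ?_
  refine (sweepR (w := sx) rfl m _ _).trans ?_
  have h := sweepR (q := C) (s := sz) (w := sr) rfl j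
    (List.replicate m sx ++ sa :: sx :: L) []
  rw [List.append_nil] at h
  refine h.trans ?_
  refine ReflTransGen.head (b := ml C (List.replicate j sr ++
    (List.replicate m sx ++ sa :: sx :: L)) [sz]) rfl ?_
  refine (sweepL (w := sz) rfl j _ _).trans ?_
  refine (sweepL (w := s1) rfl m _ _).trans ?_
  refine ReflTransGen.single ?_
  rw [rep_shift, List.append_nil, List.replicate_succ]
  rfl

theorem rounds (k m : ℕ) : ∀ (L : List Sym) (j : ℕ),
    RR (A, L, List.replicate (2 * k + m) s1 ++ List.replicate j sz)
      (A, ax k L, List.replicate m s1 ++ List.replicate (j + k) sz) := by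
  induction k with
  | zero => intro L j; simpa [ax] using ReflTransGen.refl
  | succ k ih =>
    intro L j
    have h1 := (round L (2 * k + m) j).to_reflTransGen
    have h2 := ih (sa :: sx :: L) (j + 1)
    rw [show 2 * (k + 1) + m = 2 * k + m + 2 by ring, show j + (k + 1) = j + 1 + k by ring]
    exact h1.trans h2

theorem eat (k : ℕ) : ∀ (L R : List Sym),
    RR (ml A (ax k L) R) (ml A L (List.replicate (2 * k) s1 ++ R)) := by
  induction k with
  | zero => intro L R; simpa [ax] using ReflTransGen.refl
  | succ k ih =>
    intro L R
    rw [ax_succ]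
    refine ReflTransGen.head (b := ml A (sx :: ax k L) (s1 :: R)) rfl ?_
    refine ReflTransGen.head (b := ml A (ax k L) (s1 :: s1 :: R)) rfl ?_
    have := ih L (s1 :: s1 :: R)
    rw [rep_shift, rep_shift] at this
    exact this

theorem even_run (k : ℕ) (L : List Sym) :
    ∃ L', TransGen R1 (A, L, List.replicate (2 * (k + 1)) s1)
      (A, sb :: L', List.replicate (k + 1) s1) := by
  refine ⟨ax (k + 1) L, ?_⟩
  have h := rounds (k + 1) 0 L 0
  simp only [add_zero, List.replicate_zero, List.append_nil, List.nil_append, zero_add] at h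
  refine TransGen.trans_right h ?_
  refine TransGen.head' (b := (B, sr :: ax (k + 1) L, List.replicate k sz)) rfl ?_
  have h := sweepR (q := B) (s := sz) (w := sx) rfl k (sr :: ax (k + 1) L) []
  rw [List.append_nil] at h
  refine h.trans ?_
  refine ReflTransGen.head
    (b := ml B (List.replicate k sx ++ sr :: ax (k + 1) L) [s1]) rfl ?_
  refine (sweepL (w := s1) rfl k _ _).trans ?_
  rw [rep_shift, List.append_nil]
  exact ReflTransGen.single rfl

theorem odd_run (k : ℕ) (L : List Sym) :
    TransGen R1 (A, sb :: L, List.replicate (2 * (k + 1) + 1) s1)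
      (A, sb :: L, List.replicate (3 * k + 5) s1) := by
  have h := rounds (k + 1) 1 (sb :: L) 0
  simp only [List.replicate_zero, List.append_nil, zero_add] at h
  refine TransGen.trans_right h ?_
  refine TransGen.head' (b := (D, sx :: ax (k + 1) (sb :: L), List.replicate (k + 1) sz)) rfl ?_
  refine ReflTransGen.head
    (b := (B, sx :: sx :: ax (k + 1) (sb :: L), List.replicate k sz)) rfl ?_
  have h := sweepR (q := B) (s := sz) (w := sx) rfl k (sx :: sx :: ax (k + 1) (sb :: L)) []
  rw [List.append_nil, rep_shift, rep_shift] at h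
  refine h.trans ?_
  refine ReflTransGen.head
    (b := ml B (List.replicate (k + 2) sx ++ ax (k + 1) (sb :: L)) [s1]) rfl ?_
  refine (sweepL (w := s1) rfl (k + 2) _ _).trans ?_
  rw [rep_shift, List.append_nil, ax_succ]
  refine ReflTransGen.head (b := ml A (sx :: ax k (sb :: L))
    (s1 :: s1 :: List.replicate (k + 2) s1)) rfl ?_
  refine ReflTransGen.head (b := ml A (ax k (sb :: L))
    (s1 :: s1 :: s1 :: List.replicate (k + 2) s1)) rfl ?_
  refine (eat k _ _).trans ?_
  refine ReflTransGen.single ?_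
  have e : List.replicate (2 * k) s1 ++ s1 :: s1 :: s1 :: List.replicate (k + 2) s1
      = List.replicate (3 * k + 5) s1 := by
    rw [← List.replicate_succ, ← List.replicate_succ, ← List.replicate_succ,
      List.replicate_append_replicate]
    congr 1; ring
  rw [e]
  rfl

theorem big_run (n : ℕ) (hn : 2 ≤ n) (L : List Sym) :
    ∃ L', TransGen R1 (A, sb :: L, List.replicate n s1)
      (A, sb :: L', List.replicate (T n) s1) := by
  rcases Nat.even_or_odd' n with ⟨m, rfl | rfl⟩
  · obtain ⟨k, rfl⟩ : ∃ k, m = k + 1 := ⟨m - 1, by omega⟩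
    have : T (2 * (k + 1)) = k + 1 := by
      unfold T; rw [if_pos (by omega)]; omega
    rw [this]
    exact even_run k _
  · obtain ⟨k, rfl⟩ : ∃ k, m = k + 1 := ⟨m - 1, by omega⟩
    have : T (2 * (k + 1) + 1) = 3 * k + 5 := by
      unfold T; rw [if_neg (by omega)]; omega
    rw [this]
    exact ⟨L, odd_run k L⟩

theorem T_pos {n : ℕ} (hn : 0 < n) : 0 < T n := by
  unfold T; split_ifs <;> omega

theorem reach_of_halts (N : ℕ) : ∀ (n : ℕ) (L : List Sym), 0 < n →
    zsteps N (A, sb :: L, List.replicate n s1) = none → ∃ j, T^[j] n = 1 := by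
  induction N using Nat.strong_induction_on with
  | _ N ih =>
    intro n L hn h
    by_cases h1 : n = 1
    · exact ⟨0, h1⟩
    · obtain ⟨L', hL⟩ := big_run n (by omega) L
      obtain ⟨m, hm, h2⟩ := trans_halts hL h
      obtain ⟨j, hj⟩ := ih m hm _ _ (T_pos hn) h2
      exact ⟨j + 1, hj⟩

theorem halts_of_reach (j : ℕ) : ∀ (n : ℕ) (L : List Sym), 0 < n →
    T^[j] n = 1 → ∃ N, zsteps N (A, sb :: L, List.replicate n s1) = none := by
  have one : ∀ L, ∃ N, zsteps N (A, sb :: L, List.replicate 1 s1) = none := fun L => ⟨3, rfl⟩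
  induction j with
  | zero =>
    intro n L _ h
    obtain rfl : n = 1 := h
    exact one L
  | succ j ih =>
    intro n L hn h
    by_cases h1 : n = 1
    · subst h1; exact one L
    · obtain ⟨L', hL⟩ := big_run n (by omega) L
      obtain ⟨N, hN⟩ := ih (T n) L' (T_pos hn) h
      exact trans_halts_back hL hN

theorem rep_init (w : List Sym) : Rep (initCfg w) (A, [sb], w) := by
  refine ⟨rfl, ?_, ?_⟩
  · intro i
    have : ¬ (0 : ℤ) ≤ 0 - 1 - i := by omega
    simp only [initCfg, tapeOf, if_neg this]
    cases i <;> simp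
  · intro i
    simp [initCfg, tapeOf]

theorem collatz_iff : CollatzConjecture ↔ ∀ n : ℕ, 0 < n → ∃ j, T^[j] n = 1 := by
  constructor
  · intro h n hn
    obtain ⟨k, _, hk⟩ := h n hn
    exact ⟨k + 1, hk⟩
  · intro h n hn
    obtain ⟨j, hj⟩ := h n hn
    refine ⟨j + 1, ?_, ?_⟩
    · rw [Function.iterate_succ_apply', hj]; rfl
    · rw [Function.iterate_succ_apply', Function.iterate_succ_apply', hj]; rfl

/-- The 3x+1 conjecture holds iff for every positive integer `n`, the machine `M5`
halts when started from `ωb (A 1) 1^{n-1} bω` (the number `n` in unary). -/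
theorem collatz_iff_M5_halts :
    CollatzConjecture ↔
      ∀ n : ℕ, 0 < n → Halts (initCfg (List.replicate n s1)) := by
  rw [collatz_iff]
  refine forall_congr' fun n => forall_congr' fun hn => ?_
  have hr := rep_init (List.replicate n s1)
  constructor
  · rintro ⟨j, hj⟩
    obtain ⟨N, hN⟩ := halts_of_reach j n [] hn hj
    exact ⟨N, hr.steps_none.2 hN⟩
  · rintro ⟨N, hN⟩
    exact reach_of_halts N n [] hn (hr.steps_none.1 hN)

end Collatz
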